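/- In any bounded quasi-implication algebra, ((((x·0)·(y·0))·((y·0)·(x·0)))·(x·0))·0 = ((x·y)·(x·0))·0, and this element is the greatest lower bound of {x, y} with respect to the induced partial order. -/

import Mathlib

/-- In any bounded quasi-implication algebra,
`((((x·0)·(y·0))·((y·0)·(x·0)))·(x·0))·0 = ((x·y)·(x·0))·0`, and this element is
the greatest lower bound of `{x, y}` with respect to the induced order. -/
theorem bqia_meet_identity_and_glb {A : Type*} (op : A → A → A) (zero : A)
    (q1 : ∀ x y : A, op (op x y) x = x)
    (q2 : ∀ x y z : A, op (op x y) (op x z) = op (op y x) (op y z))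
    (q3 : ∀ x y : A, op (op (op x y) (op y x)) x = op (op (op y x) (op x y)) y)
    (hz : ∀ x : A, op zero x = op x x) :
    ∀ r : A → A → Prop, (∀ x y : A, r x y ↔ op x y = op x x) →
      ∀ x y : A,
        op (op (op (op (op x zero) (op y zero))
            (op (op y zero) (op x zero))) (op x zero)) zero
          = op (op (op x y) (op x zero)) zero ∧
        r (op (op (op x y) (op x zero)) zero) x ∧
        r (op (op (op x y) (op x zero)) zero) y ∧
        (∀ z : A, r z x → r z y → r z (op (op (op x y) (op x zero)) zero)) := by
  have absorb : ∀ x y, op x (op x y) = op x y := fun x y => by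
    have h := q1 (op x y) x
    rwa [q1 x y] at h
  have self_op : ∀ x y, op (op y x) (op y x) = op x x := fun x y => by
    have h := q2 x (op x y) x
    rw [absorb, q1] at h
    rw [← q2 x y x, h]
  have self_eq : ∀ x y, op x x = op y y := fun x y => by
    rw [← self_op x (op (op x y) (op y x)), q3, self_op]
  obtain ⟨one, self⟩ : ∃ e, ∀ x, op x x = e := ⟨op zero zero, fun x => self_eq x zero⟩
  have one_op : ∀ x, op one x = x := fun x => by rw [← self x, q1]
  have op_one : ∀ x, op x one = one := fun x => by rw [← self x, absorb]
  have zero_op : ∀ x, op zero x = one := fun x => by rw [hz, self]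
  have antisymm : ∀ x y, op x y = one → op y x = one → x = y := fun x y h k => by
    have := q3 x y
    rwa [h, k, self, one_op, one_op] at this
  have compl_le : ∀ x z, op (op x zero) (op x z) = one := fun x z => by
    rw [q2, zero_op, zero_op, self]
  have compl_compl : ∀ x, op (op x zero) zero = x := fun x => by
    have h := q3 x zero
    rw [zero_op, op_one, one_op, one_op] at h
    exact h.symm
  have trans : ∀ x y z, op x y = one → op y z = one → op x z = one := fun x y z h k => by
    rw [← one_op (op x z), ← h, q2, k, op_one, h]
  have le_op : ∀ x y, op x y = one → op x (op y x) = one := fun x y h => by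
    rw [← one_op (op x _), ← h, q2, absorb, self, h]
  have mono : ∀ t x y, op x y = one → op (op t x) (op t y) = one := fun t x y h => by
    rw [q2, h, op_one]
  have compl_eq : ∀ x y, op x y = one → op x zero = op (op y x) (op y zero) :=
    fun x y h => by rw [q2, h, one_op]
  have anti : ∀ x y, op x y = one → op (op y zero) (op x zero) = one := fun x y h => by
    rw [compl_eq x y h]
    exact le_op _ _ (compl_le y x)
  have op_anti : ∀ a b c, op c a = one → op a b = one →
      op (op b c) (op a c) = one := fun a b c h k => by
    have e : op a c = op (op b a) (op b c) := by rw [q2 b a c, k, one_op]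
    rw [e]
    exact le_op _ _ (mono b c a h)
  have meet_le : ∀ x y, op (op (op (op x y) (op x zero)) zero) x = one := fun x y => by
    have h := anti _ _ (le_op _ _ (compl_le x y))
    rwa [compl_compl] at h
  have meet_le' : ∀ x y, op (op (op (op x y) (op x zero)) zero) y = one := fun x y => by
    rw [q2]
    exact meet_le y x
  have le_meet : ∀ x y z, op z x = one → op z y = one →
      op z (op (op (op x y) (op x zero)) zero) = one := fun x y z h k => by
    have e : op (op (op x y) (op x zero)) (op z zero) = one := by
      rw [compl_eq z x h]
      exact op_anti _ _ _ (compl_le x z) (mono x z y k)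
    have := anti _ _ e
    rwa [compl_compl] at this
  have op_eq_right : ∀ t w, op (op w zero) t = one → op t w = w := fun t w h => by
    have e := compl_eq _ _ h
    rw [compl_compl] at e
    have key : ∀ s, op t (op (op t s) (op t zero)) = op (op t s) (op t zero) := fun s => by
      have h₁ := q2 (op t s) t (op t zero)
      rwa [q1, absorb, absorb] at h₁
    rw [e]
    exact key _
  have le_join : ∀ u v, op u (op (op (op u v) (op v u)) u) = one := fun u v => by
    apply le_op
    have h := q2 (op u v) u (op v u)
    rw [q1, absorb, q2 u v, absorb, self] at h
    exact h
  have join_le : ∀ u v w, op u w = one → op v w = one →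
      op (op (op (op u v) (op v u)) u) w = one := fun u v w h k => by
    have hp := trans _ _ _ (anti _ _ h) (compl_le u v)
    have hq := trans _ _ _ (anti _ _ k) (compl_le v u)
    have ht := trans _ _ _ (le_op _ _ hp) (mono (op u v) _ _ hq)
    have := mono (op (op u v) (op v u)) _ _ h
    rwa [op_eq_right _ _ ht] at this
  intro r hr x y
  simp only [hr, self]
  refine ⟨?_, meet_le x y, meet_le' x y, le_meet x y⟩
  apply antisymm
  · apply le_meet
    · have := anti _ _ (le_join (op x zero) (op y zero))
      rwa [compl_compl x] at this
    · have := anti _ _ (le_join (op y zero) (op x zero))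
      rw [q3]
      rwa [compl_compl y] at this
  · have hx := anti _ _ (meet_le x y)
    have hy := anti _ _ (meet_le' x y)
    exact anti _ _ (by
      rw [compl_compl] at hx hy
      exact join_le _ _ _ hx hy)
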